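/- arXiv:2605.19514 — 2 statements merged into one kernel-verified Lean document; each statement's English description precedes it below -/
import Mathlib

section
/- Suppose |Σ| ≥ 2. For every integer N ≥ 3 and every next-token function f : Σ^{≤N} → Σ such that the summarization-style system determined by (N, f) halts on every input, there exists a deterministic finite automaton over Σ with at most |Σ|^{N+1} states that accepts exactly the language {x ∈ Σ* : the system accepts x}. -/
/-!
The summarization-style context-management system.

The alphabet is a finite type `A` containing distinguished tokens
`sTok` (`<s>`, summary instruction), `eosTok` (`<EOS>`), `accTok` (`ACC`),
`rejTok` (`REJ`).  `N` is the context-window length, and `f : List A → A`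
abstracts one decoding step of a fixed finite-precision Transformer with a
deterministic decoding rule (the system only ever evaluates `f` on strings
of length at most `N`).
-/

variable {A : Type} [DecidableEq A]

/-- The token decoded from the maintained string `r`:
in the normal phase (`|r| < N - 1`) it is `f r`; in the summarization phase
(`|r| ≥ N - 1`) it is `f (<s> · r₁ ⋯ r_{N-1})`. -/
def sumDec (N : ℕ) (sTok : A) (f : List A → A) (r : List A) : A :=
  if r.length < N - 1 then f r else f (sTok :: r.take (N - 1))

/-- One step of the summarization-style system: `none` means the system halts
(the decoded token in the normal phase was `<EOS>`). -/
def sumStep (N : ℕ) (sTok eosTok : A) (f : List A → A) (r : List A) :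
    Option (List A) :=
  if r.length < N - 1 then
    if f r = eosTok then none else some (r ++ [f r])
  else
    some (f (sTok :: r.take (N - 1)) :: r.drop (N - 1))

/-- `sumTraj N sTok eosTok f x t` is the maintained string `r⁽ᵗ⁺¹⁾` (so index `0`
corresponds to `r⁽¹⁾ = x`), or `none` if the system has halted by then. -/
def sumTraj (N : ℕ) (sTok eosTok : A) (f : List A → A) (x : List A) :
    ℕ → Option (List A)
  | 0 => some x
  | t + 1 => (sumTraj N sTok eosTok f x t).bind (sumStep N sTok eosTok f)

/-- The system halts on input `x`. -/
def sumHalts (N : ℕ) (sTok eosTok : A) (f : List A → A) (x : List A) : Prop :=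
  ∃ t, sumTraj N sTok eosTok f x t = none

/-- The system accepts `x`: at some step the decoded token is `ACC`. -/
def sumAccepts (N : ℕ) (sTok eosTok accTok : A) (f : List A → A)
    (x : List A) : Prop :=
  ∃ t r, sumTraj N sTok eosTok f x t = some r ∧ sumDec N sTok f r = accTok

theorem sumTraj_succ_eq_bind (N : ℕ) (sTok eosTok : A) (f : List A → A) (x : List A) (t : ℕ) :
    sumTraj N sTok eosTok f x (t + 1) =
      (sumStep N sTok eosTok f x).bind fun y => sumTraj N sTok eosTok f y t := by
  induction t with
  | zero => simp [sumTraj]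
  | succ t ih =>
    rw [sumTraj, ih, Option.bind_assoc]
    rfl

theorem sumAccepts_iff (N : ℕ) (sTok eosTok accTok : A) (f : List A → A) (x : List A) :
    sumAccepts N sTok eosTok accTok f x ↔
      sumDec N sTok f x = accTok ∨
        ∃ y, sumStep N sTok eosTok f x = some y ∧ sumAccepts N sTok eosTok accTok f y := by
  constructor
  · rintro ⟨t, r, ht, hr⟩
    cases t with
    | zero =>
      obtain rfl : x = r := Option.some.inj ht
      exact Or.inl hr
    | succ t =>
      rw [sumTraj_succ_eq_bind, Option.bind_eq_some_iff] at ht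
      obtain ⟨y, hy, hty⟩ := ht
      exact Or.inr ⟨y, hy, t, r, hty, hr⟩
  · rintro (h | ⟨y, hy, t, r, ht, hr⟩)
    · exact ⟨0, x, rfl, h⟩
    · exact ⟨t + 1, r, by rw [sumTraj_succ_eq_bind, hy]; exact ht, hr⟩

/-- A prefix of length `N - 1` is compressed to a single token. -/
theorem sumAccepts_append_iff (N : ℕ) (sTok eosTok accTok : A) (f : List A → A)
    (w x : List A) (hw : w.length = N - 1) :
    sumAccepts N sTok eosTok accTok f (w ++ x) ↔
      f (sTok :: w) = accTok ∨ sumAccepts N sTok eosTok accTok f (f (sTok :: w) :: x) := by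
  have hlen : ¬ (w ++ x).length < N - 1 := by simp [hw]
  have htake : (w ++ x).take (N - 1) = w := List.take_left' hw
  have hdrop : (w ++ x).drop (N - 1) = x := List.drop_left' hw
  rw [sumAccepts_iff, sumDec, sumStep, if_neg hlen, if_neg hlen, htake, hdrop]
  simp

/-- The buffers of length less than `n`, embedded in a sigma type of vectors. -/
def boundedListToSigma {B : Type} (n : ℕ) (l : {l : List B // l.length < n}) :
    Σ k : Fin n, List.Vector B k :=
  ⟨⟨l.1.length, l.2⟩, ⟨l.1, rfl⟩⟩

theorem boundedListToSigma_injective {B : Type} (n : ℕ) :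
    Function.Injective (boundedListToSigma (B := B) n) := by
  intro l m h
  exact Subtype.ext (congrArg (fun p : Σ k : Fin n, List.Vector B k => p.2.1) h)

open Classical in
/-- The automaton keeps the current buffer, compressing it whenever it reaches length `N - 1`;
the state `none` records that `accTok` has been decoded. -/
noncomputable def sumDFA (N : ℕ) (hN : 3 ≤ N) (sTok eosTok accTok : A) (f : List A → A) :
    DFA A (Option {l : List A // l.length < N - 1}) where
  step s a := s.bind fun w =>
    if h : (w.1 ++ [a]).length < N - 1 then some ⟨w.1 ++ [a], h⟩
    else if f (sTok :: (w.1 ++ [a])) = accTok then none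
    else some ⟨[f (sTok :: (w.1 ++ [a]))], by rw [List.length_singleton]; omega⟩
  start := some ⟨[], by rw [List.length_nil]; omega⟩
  accept := {s | ∀ w, s = some w → sumAccepts N sTok eosTok accTok f w.1}

theorem sumDFA_evalFrom_none (N : ℕ) (hN : 3 ≤ N) (sTok eosTok accTok : A) (f : List A → A)
    (x : List A) : (sumDFA N hN sTok eosTok accTok f).evalFrom none x = none := by
  induction x with
  | nil => rfl
  | cons a x ih => exact ih

theorem sumDFA_evalFrom_mem_accept_iff (N : ℕ) (hN : 3 ≤ N) (sTok eosTok accTok : A)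
    (f : List A → A) (x : List A) (w : {l : List A // l.length < N - 1}) :
    (sumDFA N hN sTok eosTok accTok f).evalFrom (some w) x ∈
        (sumDFA N hN sTok eosTok accTok f).accept ↔
      sumAccepts N sTok eosTok accTok f (w.1 ++ x) := by
  induction x generalizing w with
  | nil =>
    rw [List.append_nil]
    exact ⟨fun h => h w rfl, fun h v hv => Option.some.inj hv ▸ h⟩
  | cons a x ih =>
    rw [DFA.evalFrom_cons, ← List.singleton_append, ← List.append_assoc]
    by_cases h : (w.1 ++ [a]).length < N - 1
    · have hs : (sumDFA N hN sTok eosTok accTok f).step (some w) a = some ⟨w.1 ++ [a], h⟩ :=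
        dif_pos h
      rw [hs, ih]
    · have hw : (w.1 ++ [a]).length = N - 1 := by
        have := w.2
        rw [List.length_append, List.length_singleton] at h ⊢
        omega
      rw [sumAccepts_append_iff N sTok eosTok accTok f _ x hw]
      by_cases hacc : f (sTok :: (w.1 ++ [a])) = accTok
      · have hs : (sumDFA N hN sTok eosTok accTok f).step (some w) a = none :=
          (dif_neg h).trans (if_pos hacc)
        rw [hs, sumDFA_evalFrom_none]
        simp [sumDFA, hacc]
      · have hs : (sumDFA N hN sTok eosTok accTok f).step (some w) a =
            some ⟨[f (sTok :: (w.1 ++ [a]))], by rw [List.length_singleton]; omega⟩ :=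
          (dif_neg h).trans (if_neg hacc)
        rw [hs, ih]
        simp [hacc]

/-- If `|Σ| ≥ 2`, then for every `N ≥ 3` and every next-token
function `f` such that the summarization-style system determined by `(N, f)`
halts on every input, there is a DFA over `Σ` with at most `|Σ|^(N+1)` states
accepting exactly the language accepted by the system. -/
theorem summarization_system_dfa_state_bound
    (A : Type) [Fintype A] [DecidableEq A] (hA : 2 ≤ Fintype.card A)
    (sTok eosTok accTok rejTok : A)
    (N : ℕ) (hN : 3 ≤ N) (f : List A → A)
    (hhalt : ∀ x : List A, sumHalts N sTok eosTok f x) :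
    ∃ (σ : Type) (hσ : Fintype σ) (M : DFA A σ),
      @Fintype.card σ hσ ≤ Fintype.card A ^ (N + 1) ∧
      ∀ x : List A, x ∈ M.accepts ↔ sumAccepts N sTok eosTok accTok f x := by
  let σ := Option {l : List A // l.length < N - 1}
  let e := Function.Embedding.mk _ (boundedListToSigma_injective (B := A) (N - 1))
  let hσ : Fintype σ := Fintype.ofInjective _ e.optionMap.injective
  refine ⟨σ, hσ, sumDFA N hN sTok eosTok accTok f, ?_, fun x => ?_⟩
  · calc Fintype.card σ
        ≤ Fintype.card (Option (Σ k : Fin (N - 1), List.Vector A k)) :=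
          Fintype.card_le_of_injective _ e.optionMap.injective
      _ = ∑ k ∈ Finset.range (N - 1), Fintype.card A ^ k + 1 := by
          simp [Finset.sum_range]
      _ ≤ Fintype.card A ^ (N - 1) :=
          Nat.geomSum_lt hA fun k hk => Finset.mem_range.mp hk
      _ ≤ Fintype.card A ^ (N + 1) := Nat.pow_le_pow_right (by omega) (by omega)
  · exact sumDFA_evalFrom_mem_accept_iff N hN sTok eosTok accTok f x _
end

section
/- Let Σ₀ ⊆ Σ \ {<s>, <EOS>, ACC, REJ} contain at least the symbols 0, 1, and #. There exist no integer N ≥ 3 and next-token function f : Σ^{≤N} → Σ such that the summarization-style system determined by (N, f) decides the binary-addition language {bin(x) # bin(y) # bin(z) : x, y, z ∈ ℕ, x + y = z} over Σ₀, where bin(n) denotes the standard most-significant-bit-first binary representation of n without leading zeros (bin(0) = "0"). -/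
/-!
The summarization-style context-management system.

The alphabet is a finite type `A` containing distinguished tokens
`sTok` (`<s>`, summary instruction), `eosTok` (`<EOS>`), `accTok` (`ACC`),
`rejTok` (`REJ`).  `N` is the context-window length, and `f : List A → A`
abstracts one decoding step of a fixed finite-precision Transformer with a
deterministic decoding rule (the system only ever evaluates `f` on strings
of length at most `N`).
-/

variable {A : Type} [DecidableEq A]

/-- The system rejects `x`: at some step the decoded token is `REJ`. -/
def sumRejects (N : ℕ) (sTok eosTok rejTok : A) (f : List A → A)
    (x : List A) : Prop :=
  ∃ t r, sumTraj N sTok eosTok f x t = some r ∧ sumDec N sTok f r = rejTok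

/-- The system decides the language `L ⊆ Σ₀*`: on every input `x ∈ Σ₀*` it
halts, it accepts `x` iff `x ∈ L`, and it rejects `x` iff `x ∉ L`. -/
def sumDecides (N : ℕ) (sTok eosTok accTok rejTok : A) (f : List A → A)
    (S₀ : Set A) (L : Set (List A)) : Prop :=
  ∀ x : List A, (∀ c ∈ x, c ∈ S₀) →
    sumHalts N sTok eosTok f x ∧
    (sumAccepts N sTok eosTok accTok f x ↔ x ∈ L) ∧
    (sumRejects N sTok eosTok rejTok f x ↔ x ∉ L)

/-- `binRepr c0 c1 n` is the standard most-significant-bit-first binary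
representation of `n` without leading zeros, written with the digit tokens
`c0` (for bit 0) and `c1` (for bit 1); `binRepr c0 c1 0 = [c0]`
(i.e. `bin 0 = "0"`).  (`Nat.bits n` lists the bits of `n` least significant
first, with no trailing zeros.) -/
def binRepr (c0 c1 : A) (n : ℕ) : List A :=
  if n = 0 then [c0]
  else (Nat.bits n).reverse.map (fun bit => if bit then c1 else c0)

section SummarizationSystem

variable {N : ℕ} {sTok eosTok : A} {f : List A → A}

lemma sumTraj_add {x r : List A} {t : ℕ} (h : sumTraj N sTok eosTok f x t = some r) (k : ℕ) :
    sumTraj N sTok eosTok f x (t + k) = sumTraj N sTok eosTok f r k := by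
  induction k with
  | zero => simpa [sumTraj] using h
  | succ k ih => rw [← add_assoc, sumTraj, ih, sumTraj]

/-- While a prefix of length `t * (N - 2) + 1` is being consumed, the rest of the input is
untouched and has no influence. -/
lemma exists_sumTraj_append (hN : 3 ≤ N) {t : ℕ} {p : List A}
    (hp : p.length = t * (N - 2) + 1) {i : ℕ} (hi : i ≤ t) :
    ∃ r : List A, r.length = (t - i) * (N - 2) + 1 ∧
      ∀ s, sumTraj N sTok eosTok f (p ++ s) i = some (r ++ s) := by
  induction i with
  | zero => exact ⟨p, by simpa using hp, fun s => rfl⟩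
  | succ i ih =>
    obtain ⟨r, hr, hs⟩ := ih (by omega)
    have hti : t - i = (t - (i + 1)) + 1 := by omega
    rw [hti, add_mul] at hr
    refine ⟨f (sTok :: r.take (N - 1)) :: r.drop (N - 1), ?_, fun s => ?_⟩
    · simp only [List.length_cons, List.length_drop]
      omega
    · have hlen : ¬ (r ++ s).length < N - 1 := by
        rw [List.length_append]
        omega
      rw [sumTraj, hs, Option.bind_some, sumStep, if_neg hlen,
        List.take_append_of_le_length (by omega), List.drop_append_of_le_length (by omega),
        List.cons_append]

lemma exists_sumTraj_append_eq_cons (hN : 3 ≤ N) {t : ℕ} {p : List A}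
    (hp : p.length = t * (N - 2) + 1) :
    ∃ a : A, ∀ s, sumTraj N sTok eosTok f (p ++ s) t = some (a :: s) := by
  obtain ⟨r, hr, hs⟩ := exists_sumTraj_append (sTok := sTok) (eosTok := eosTok) (f := f) hN hp le_rfl
  obtain ⟨a, rfl⟩ := List.length_eq_one_iff.mp (by simpa using hr)
  exact ⟨a, hs⟩

/-- If two prefixes are summarized to the same token, then an accepting run on the first one
followed by `s` accepts within the first prefix or transfers to the second one. -/
lemma sumAccepts_of_summary_eq {accTok : A} (hN : 3 ≤ N) {t : ℕ} {p q s : List A} {a : A}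
    (hp : p.length = t * (N - 2) + 1)
    (hpa : sumTraj N sTok eosTok f (p ++ s) t = some (a :: s))
    (hqa : sumTraj N sTok eosTok f (q ++ s) t = some (a :: s))
    (h : sumAccepts N sTok eosTok accTok f (p ++ s)) :
    sumAccepts N sTok eosTok accTok f p ∨ sumAccepts N sTok eosTok accTok f (q ++ s) := by
  obtain ⟨i, r, hr, hd⟩ := h
  rcases lt_or_ge i t with hi | hi
  · left
    obtain ⟨r', hr', hs⟩ :=
      exists_sumTraj_append (sTok := sTok) (eosTok := eosTok) (f := f) hN hp hi.le
    obtain rfl : r' ++ s = r := Option.some.inj ((hs s).symm.trans hr)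
    have hti : t - i = (t - (i + 1)) + 1 := by omega
    rw [hti, add_mul] at hr'
    refine ⟨i, r', by simpa using hs [], ?_⟩
    have hlen : ¬ (r' ++ s).length < N - 1 := by
      rw [List.length_append]
      omega
    rw [sumDec, if_neg hlen, List.take_append_of_le_length (by omega)] at hd
    rwa [sumDec, if_neg (by omega)]
  · right
    obtain ⟨k, rfl⟩ := Nat.exists_eq_add_of_le hi
    exact ⟨t + k, r, by rw [sumTraj_add hqa, ← sumTraj_add hpa, hr], hd⟩

end SummarizationSystem

section BinaryRepresentation

variable {α : Type} {c0 c1 : α}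

lemma eq_or_eq_of_mem_binRepr {n : ℕ} {c : α} (h : c ∈ binRepr c0 c1 n) : c = c0 ∨ c = c1 := by
  unfold binRepr at h
  split_ifs at h
  · simp_all
  · obtain ⟨b, -, rfl⟩ := List.mem_map.mp h
    cases b <;> simp

lemma length_binRepr {n : ℕ} (hn : n ≠ 0) : (binRepr c0 c1 n).length = n.size := by
  simp [binRepr, hn, Nat.size_eq_bits_len]

lemma binRepr_injective (h01 : c0 ≠ c1) : Function.Injective (binRepr c0 c1) := by
  classical
  have hval : ∀ n, Nat.ofDigits 2
      ((binRepr c0 c1 n).reverse.map (fun c => if c = c1 then 1 else 0)) = n := by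
    intro n
    by_cases hn : n = 0
    · simp [binRepr, hn, h01]
    · rw [binRepr, if_neg hn, ← List.map_reverse, List.reverse_reverse, List.map_map]
      conv_rhs => rw [← Nat.ofDigits_digits 2 n, Nat.digits_two_eq_bits]
      congr 2
      funext b
      cases b <;> simp [h01]
  exact Function.LeftInverse.injective (g := fun l : List α =>
    Nat.ofDigits 2 (l.reverse.map (fun c => if c = c1 then 1 else 0))) hval

end BinaryRepresentation

lemma append_cons_inj_of_notMem {α : Type*} {c : α} {l₁ l₂ r₁ r₂ : List α}
    (h₁ : c ∉ l₁) (h₂ : c ∉ l₂) (h : l₁ ++ c :: r₁ = l₂ ++ c :: r₂) : l₁ = l₂ ∧ r₁ = r₂ := by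
  induction l₁ generalizing l₂ with
  | nil =>
    cases l₂ with
    | nil => exact ⟨rfl, (List.cons.inj h).2⟩
    | cons b l₂ => exact absurd (List.cons.inj h).1 (List.ne_of_not_mem_cons h₂)
  | cons a l₁ ih =>
    cases l₂ with
    | nil => exact absurd (List.cons.inj h).1.symm (List.ne_of_not_mem_cons h₁)
    | cons b l₂ =>
      simp only [List.mem_cons, not_or, List.cons_append, List.cons.injEq] at h₁ h₂ h ⊢
      exact ⟨⟨h.1, (ih h₁.2 h₂.2 h.2).1⟩, (ih h₁.2 h₂.2 h.2).2⟩

lemma add_eq_of_binRepr_append_eq {α : Type} {c0 c1 chash : α} (h01 : c0 ≠ c1) (h0h : c0 ≠ chash)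
    (h1h : c1 ≠ chash) {x y z u v w : ℕ} (huvw : u + v = w)
    (h : binRepr c0 c1 x ++ chash :: binRepr c0 c1 y ++ chash :: binRepr c0 c1 z =
      binRepr c0 c1 u ++ chash :: binRepr c0 c1 v ++ chash :: binRepr c0 c1 w) :
    x + y = z := by
  have hmem : ∀ n, chash ∉ binRepr c0 c1 n := fun n hn =>
    (eq_or_eq_of_mem_binRepr hn).elim h0h.symm h1h.symm
  rw [List.append_assoc, List.append_assoc, List.cons_append, List.cons_append] at h
  obtain ⟨hx, h⟩ := append_cons_inj_of_notMem (hmem x) (hmem u) h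
  obtain ⟨hy, hz⟩ := append_cons_inj_of_notMem (hmem y) (hmem v) h
  rw [binRepr_injective h01 hx, binRepr_injective h01 hy, binRepr_injective h01 hz, huvw]

/-- Let `Σ₀ ⊆ Σ \ {<s>, <EOS>, ACC, REJ}` contain at least the
(distinct) symbols `0`, `1`, `#`. No summarization-style system (for any
`N ≥ 3` and next-token function `f`) decides the binary-addition language
`{bin(x) # bin(y) # bin(z) : x + y = z}` over `Σ₀`. -/
theorem no_summarization_system_decides_binary_addition
    (A : Type) [Fintype A] [DecidableEq A]
    (sTok eosTok accTok rejTok : A) (c0 c1 chash : A) (S₀ : Set A)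
    (hS₀ : ∀ a ∈ S₀, a ≠ sTok ∧ a ≠ eosTok ∧ a ≠ accTok ∧ a ≠ rejTok)
    (h0 : c0 ∈ S₀) (h1 : c1 ∈ S₀) (hh : chash ∈ S₀)
    (h01 : c0 ≠ c1) (h0h : c0 ≠ chash) (h1h : c1 ≠ chash) :
    ¬ ∃ (N : ℕ) (f : List A → A), 3 ≤ N ∧
        sumDecides N sTok eosTok accTok rejTok f S₀
          {l | ∃ x y z : ℕ, x + y = z ∧
            l = binRepr c0 c1 x ++ chash :: binRepr c0 c1 y ++
                chash :: binRepr c0 c1 z} := by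
  rintro ⟨N, f, hN, hdec⟩
  set t := Fintype.card A with ht
  set M := t * (N - 2)
  have htM : t < 2 ^ M := Nat.lt_two_pow_self.trans_le
    (Nat.pow_le_pow_right two_pos (Nat.le_mul_of_pos_right t (by omega)))
  have hpos (j : Fin (t + 1)) : 2 ^ M + (j : ℕ) ≠ 0 := by omega
  have hlen (j : Fin (t + 1)) : (binRepr c0 c1 (2 ^ M + j)).length = M + 1 := by
    rw [length_binRepr (hpos j)]
    refine le_antisymm (Nat.size_le.mpr ?_) (Nat.lt_size.mpr (by omega))
    rw [pow_succ]
    omega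
  choose summary hsummary using fun j =>
    exists_sumTraj_append_eq_cons (sTok := sTok) (eosTok := eosTok) (f := f) hN (hlen j)
  obtain ⟨i, j, hij, heq⟩ :=
    Fintype.exists_ne_map_eq_of_card_lt summary (by rw [Fintype.card_fin, ← ht]; omega)
  have hmem : ∀ n, ∀ c ∈ binRepr c0 c1 n, c ∈ S₀ := fun n c hc =>
    (eq_or_eq_of_mem_binRepr hc).elim (fun h => h ▸ h0) (fun h => h ▸ h1)
  set s := chash :: binRepr c0 c1 0 ++ chash :: binRepr c0 c1 (2 ^ M + i) with hs
  have hsmem : ∀ n, ∀ c ∈ binRepr c0 c1 n ++ s, c ∈ S₀ := by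
    intro n c hc
    simp only [hs, List.mem_append, List.mem_cons] at hc
    rcases hc with hc | (rfl | hc) | rfl | hc
    exacts [hmem _ _ hc, hh, hmem _ _ hc, hh, hmem _ _ hc]
  have hacc := (hdec _ (hsmem (2 ^ M + i))).2.1.mpr
    ⟨2 ^ M + i, 0, 2 ^ M + i, rfl, by rw [hs, List.append_assoc]⟩
  rcases sumAccepts_of_summary_eq hN (hlen i) (hsummary i s) (heq ▸ hsummary j s) hacc with h | h
  · obtain ⟨x, y, z, -, hxyz⟩ := (hdec _ (hmem _)).2.1.mp h
    have hc : chash ∈ binRepr c0 c1 (2 ^ M + i) := by simp [hxyz]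
    exact (eq_or_eq_of_mem_binRepr hc).elim h0h.symm h1h.symm
  · obtain ⟨x, y, z, hxyz, hl⟩ := (hdec _ (hsmem _)).2.1.mp h
    rw [hs, ← List.append_assoc] at hl
    have := add_eq_of_binRepr_append_eq h01 h0h h1h hxyz hl
    exact hij (Fin.ext (by omega))
end
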